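/- arXiv:1306.5345 — 7 statements merged into one kernel-verified Lean document; each statement's English description precedes it below -/
import Mathlib

section
/- Assume X is a complete metric space. Let (A_n)_{n<ω} be a ⊆-increasing sequence of subsets of X such that for every n < ω, every x ∈ X and every δ > 0 there exists y ∈ A_{n+1} with D_{A_n}(x, y) < δ (i.e. A_{n+1} realizes a dense subset of the space of Galois types over A_n). Assume moreover that every orbit of G_{A_0} is closed in X. Then for every b ∈ X there exists c in the closure of ⋃_{n<ω} A_n with c ∈ G_{A_0} • b, i.e. every Galois type over A_0 is realized in the closure of the union of the chain. -/
open Set Metric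

/-- Pointwise stabilizer of a set `A` inside the group `G`. -/
def stabSet (G : Type*) [Group G] {X : Type*} [MulAction G X] (A : Set X) : Set G :=
  {g | ∀ x ∈ A, g • x = x}

/-- Galois type of `a` over `A`: the orbit of `a` under the pointwise stabilizer `G_A`. -/
def gtp (G : Type*) [Group G] {X : Type*} [MulAction G X] (A : Set X) (a : X) : Set X :=
  {x | ∃ g ∈ stabSet G A, g • a = x}

/-- Distance between the Galois types of `a` and `b` over `A`. -/
noncomputable def Dtp (G : Type*) [Group G] {X : Type*} [MulAction G X] [MetricSpace X]
    (A : Set X) (a b : X) : ℝ :=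
  sInf {r : ℝ | ∃ x ∈ gtp G A a, ∃ y ∈ gtp G A b, r = dist x y}

/-- `tp(a/M)` ε-splits over `N`. -/
def EpsSplits (G : Type*) [Group G] {X : Type*} [MulAction G X] [MetricSpace X]
    (ε : ℝ) (N M : Set X) (a : X) : Prop :=
  ∃ N₁ N₂ : Set X, N ⊆ N₁ ∧ N₁ ⊆ M ∧ N ⊆ N₂ ∧ N₂ ⊆ M ∧
    ∃ g ∈ stabSet G N, (fun x => g • x) '' N₁ = N₂ ∧ ε ≤ Dtp G N₂ (g • a) a

/-- `(F i)_{i<σ}` is a resolution of `N`. -/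
def IsResolution {X : Type*} [MetricSpace X] (σ : Ordinal) (F : Ordinal → Set X)
    (N : Set X) : Prop :=
  (∀ i j : Ordinal, i ≤ j → j < σ → F i ⊆ F j) ∧ (∀ i : Ordinal, i < σ → F i ⊆ N) ∧
    N = closure (⋃ i ∈ {i : Ordinal | i < σ}, F i)

/-- Smooth independence of `a` from `M` over the resolution `(F i)_{i<σ}` of the base. -/
def SmoothIndep (G : Type*) [Group G] {X : Type*} [MulAction G X] [MetricSpace X]
    (σ : Ordinal) (F : Ordinal → Set X) (M : Set X) (a : X) : Prop :=
  ∀ ε : ℝ, 0 < ε → ∃ i : Ordinal, i < σ ∧ ¬ EpsSplits G ε (F i) M a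

/-- If each `A (n+1)` realizes a dense subset of the space of Galois types over `A n`
and orbits of `G_{A 0}` are closed, then every Galois type over `A 0` is realized in the
closure of the union of the chain. -/
theorem type_realized_in_closure_of_chain {G X : Type*} [Group G] [MetricSpace X]
    [MulAction G X] [CompleteSpace X]
    (hiso : ∀ (g : G) (x y : X), dist (g • x) (g • y) = dist x y)
    (A : ℕ → Set X) (hmono : Monotone A)
    (hdense : ∀ n : ℕ, ∀ x : X, ∀ δ : ℝ, 0 < δ → ∃ y ∈ A (n + 1), Dtp G (A n) x y < δ)
    (hclosed : ∀ x : X, IsClosed (gtp G (A 0) x)) :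
    ∀ b : X, ∃ c ∈ closure (⋃ n : ℕ, A n), c ∈ gtp G (A 0) b := by
  intro b
  have step : ∀ (n : ℕ) (x : X), ∃ k ∈ stabSet G (A n), ∃ y ∈ A (n + 1),
      dist (k • x) y < (1 / 2 : ℝ) ^ n := by
    intro n x
    obtain ⟨y, hy, hD⟩ := hdense n x ((1 / 2 : ℝ) ^ n) (by positivity)
    have hne : {r : ℝ | ∃ u ∈ gtp G (A n) x, ∃ v ∈ gtp G (A n) y, r = dist u v}.Nonempty :=
      ⟨dist x y, x, ⟨1, fun z _ => one_smul G z, one_smul G x⟩,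
        y, ⟨1, fun z _ => one_smul G z, one_smul G y⟩, rfl⟩
    obtain ⟨r, ⟨u, ⟨g, hg, rfl⟩, v, ⟨h, hh, rfl⟩, rfl⟩, hr⟩ := exists_lt_of_csInf_lt hne hD
    refine ⟨h⁻¹ * g, fun z hz => ?_, y, hy, ?_⟩
    · rw [mul_smul, hg z hz, inv_smul_eq_iff, hh z hz]
    · rw [← hiso h, mul_smul, smul_inv_smul]
      exact hr
  choose k hk y hy hd using step
  let s : ℕ → X := fun n => Nat.rec b (fun n x => k n x • x) n
  have hs : ∀ n, s (n + 1) = k n (s n) • s n := fun n => rfl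
  have h1 : ∀ n, dist (s (n + 1)) (y n (s n)) < (1 / 2 : ℝ) ^ n := fun n => hd n (s n)
  have h2 : ∀ n, dist (s (n + 1 + 1)) (y n (s n)) < (1 / 2 : ℝ) ^ n := by
    intro n
    have e := hiso (k (n + 1) (s (n + 1))) (s (n + 1)) (y n (s n))
    rw [hk (n + 1) (s (n + 1)) _ (hy n (s n)), ← hs] at e
    rw [e]
    exact h1 n
  have hc : CauchySeq (fun n => s (n + 1)) := by
    refine cauchySeq_of_le_geometric (1 / 2) 2 (by norm_num) fun n => ?_
    have := dist_triangle_right (s (n + 1)) (s (n + 1 + 1)) (y n (s n))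
    linarith [h1 n, h2 n]
  obtain ⟨c, hcl⟩ := cauchySeq_tendsto_of_complete hc
  have horb : ∀ n, s n ∈ gtp G (A 0) b := by
    intro n
    induction n with
    | zero => exact ⟨1, fun z _ => one_smul G z, one_smul G b⟩
    | succ n ih =>
      obtain ⟨g, hg, e⟩ := ih
      refine ⟨k n (s n) * g, fun z hz => ?_, ?_⟩
      · rw [mul_smul, hg z hz]
        exact hk n (s n) z (hmono (Nat.zero_le n) hz)
      · rw [mul_smul, e, hs]
  have hpow : Filter.Tendsto (fun n : ℕ => (1 / 2 : ℝ) ^ n) Filter.atTop (nhds 0) :=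
    tendsto_pow_atTop_nhds_zero_of_lt_one (by norm_num) (by norm_num)
  have hyl : Filter.Tendsto (fun n => y n (s n)) Filter.atTop (nhds c) :=
    hcl.congr_dist (squeeze_zero (fun _ => dist_nonneg) (fun n => (h1 n).le) hpow)
  exact ⟨c, mem_closure_of_tendsto hyl
      (Filter.Eventually.of_forall fun n => mem_iUnion.2 ⟨n + 1, hy n (s n)⟩),
    (hclosed b).mem_of_tendsto hcl (Filter.Eventually.of_forall fun n => horb (n + 1))⟩
end

section
/- (Stationarity, first form.) Let ε > 0 and N₀ ⊆ N₁ ⊆ N₂ ⊆ X, and suppose there exists g ∈ G_{N₀} with g • N₂ ⊆ N₁ (the group-theoretic rendering of 'N₁ is universal over N₀'). If G_{N₁} • a = G_{N₁} • b (a and b have the same Galois type over N₁), a ⌣[ε; N₀] N₂ and b ⌣[ε; N₀] N₂, then D_{N₂}(a, b) < 2ε. -/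
open Set Metric

theorem stab_one {G X : Type*} [Group G] [MulAction G X] (A : Set X) :
    (1 : G) ∈ stabSet G A := fun x _ => one_smul G x

theorem stab_mul {G X : Type*} [Group G] [MulAction G X] {A : Set X} {u v : G}
    (hu : u ∈ stabSet G A) (hv : v ∈ stabSet G A) : u * v ∈ stabSet G A := by
  intro x hx
  rw [mul_smul, hv x hx, hu x hx]

theorem stab_inv {G X : Type*} [Group G] [MulAction G X] {A : Set X} {u : G}
    (hu : u ∈ stabSet G A) : u⁻¹ ∈ stabSet G A := by
  intro x hx
  rw [inv_smul_eq_iff, hu x hx]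

theorem stab_conj {G X : Type*} [Group G] [MulAction G X] {A : Set X} {u g : G}
    (hu : u ∈ stabSet G ((fun x => g • x) '' A)) : g⁻¹ * u * g ∈ stabSet G A := by
  intro x hx
  rw [mul_smul, mul_smul, inv_smul_eq_iff]
  exact hu _ ⟨x, hx, rfl⟩

theorem exists_of_Dtp_lt {G X : Type*} [Group G] [MetricSpace X] [MulAction G X]
    (hiso : ∀ (g : G) (x y : X), dist (g • x) (g • y) = dist x y)
    {A : Set X} {x y : X} {r : ℝ} (h : Dtp G A x y < r) :
    ∃ u ∈ stabSet G A, dist (u • x) y < r := by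
  have hne : {r : ℝ | ∃ x' ∈ gtp G A x, ∃ y' ∈ gtp G A y, r = dist x' y'}.Nonempty :=
    ⟨dist x y, x, ⟨1, stab_one A, one_smul G x⟩, y, ⟨1, stab_one A, one_smul G y⟩, rfl⟩
  obtain ⟨s, ⟨_, ⟨p, hp, rfl⟩, _, ⟨q, hq, rfl⟩, rfl⟩, hs⟩ := exists_lt_of_csInf_lt hne h
  refine ⟨q⁻¹ * p, stab_mul (stab_inv hq) hp, ?_⟩
  rwa [← hiso q, mul_smul, smul_inv_smul]

/-- Stationarity, first form: two elements with the same Galois type over a model `N₁`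
universal over `N₀`, both non-ε-splitting over `N₀`, have types at distance `< 2ε` over `N₂`. -/
theorem stationarity_first_form {G X : Type*} [Group G] [MetricSpace X] [MulAction G X]
    (hiso : ∀ (g : G) (x y : X), dist (g • x) (g • y) = dist x y)
    (ε : ℝ) (hε : 0 < ε)
    (N₀ N₁ N₂ : Set X) (h01 : N₀ ⊆ N₁) (h12 : N₁ ⊆ N₂)
    (g : G) (hg : g ∈ stabSet G N₀) (hguniv : (fun x => g • x) '' N₂ ⊆ N₁)
    (a b : X) (htp : gtp G N₁ a = gtp G N₁ b)
    (ha : ¬ EpsSplits G ε N₀ N₂ a) (hb : ¬ EpsSplits G ε N₀ N₂ b) :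
    Dtp G N₂ a b < 2 * ε := by
  have key : ∀ c : X, ¬ EpsSplits G ε N₀ N₂ c →
      ∃ u ∈ stabSet G ((fun x => g • x) '' N₂), dist (u • g • c) c < ε := by
    intro c hc
    apply exists_of_Dtp_lt hiso
    by_contra hcon
    refine hc ⟨N₂, _, h01.trans h12, Subset.rfl, ?_, hguniv.trans h12, g, hg, rfl, not_lt.1 hcon⟩
    intro x hx
    exact ⟨x, h12 (h01 hx), hg x hx⟩
  obtain ⟨u, hu, hua⟩ := key a ha
  obtain ⟨v, hv, hvb⟩ := key b hb
  have hb1 : b ∈ gtp G N₁ a := by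
    rw [htp]
    exact ⟨1, stab_one N₁, one_smul G b⟩
  obtain ⟨f, hf, hfa⟩ := hb1
  have hf2 : f ∈ stabSet G ((fun x => g • x) '' N₂) := fun x hx => hf x (hguniv hx)
  have h1 : dist ((f * u) • g • a) b < ε := by
    rw [← hfa, mul_smul, hiso]
    exact hua
  have h2 : dist ((f * u) • g • a) (v • g • b) < 2 * ε := by
    have := dist_triangle_right ((f * u) • g • a) (v • g • b) b
    linarith
  refine lt_of_le_of_lt (csInf_le ⟨0, ?_⟩ ⟨_, ⟨_, stab_conj (stab_mul hf2 hu), rfl⟩,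
    _, ⟨_, stab_conj hv, rfl⟩, rfl⟩) ?_
  · rintro _ ⟨x, _, y, _, rfl⟩
    exact dist_nonneg
  · rw [mul_smul, mul_smul (g⁻¹), mul_smul (g⁻¹ * v), mul_smul (g⁻¹), hiso]
    exact h2
end

section
/- (Extension of smooth independence over universal models.) Let N ⊆ M ⊆ M' ⊆ X and let 𝒩 be a resolution of N. Suppose there exists h ∈ G_N with h • M' ⊆ M (the group-theoretic rendering of 'M is universal over N'), and suppose every orbit of G_M is closed in X (the Continuity of Types Property over M). If a ⌣[𝒩; N] M, then there exists b ∈ G_M • a (so that tp(b/M) = tp(a/M)) such that b ⌣[𝒩; N] M'. -/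
open Set Metric

theorem stabSet_inv {G X : Type*} [Group G] [MulAction G X] {A : Set X} {g : G}
    (hg : g ∈ stabSet G A) : g⁻¹ ∈ stabSet G A := by
  intro x hx
  rw [inv_smul_eq_iff, hg x hx]

theorem stabSet_one {G X : Type*} [Group G] [MulAction G X] {A : Set X} :
    (1 : G) ∈ stabSet G A := fun x _ => one_smul G x

theorem Dtp_le {G X : Type*} [Group G] [MetricSpace X] [MulAction G X] {A : Set X} {a b x y : X}
    (hx : x ∈ gtp G A a) (hy : y ∈ gtp G A b) : Dtp G A a b ≤ dist x y := by
  apply csInf_le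
  · refine ⟨0, ?_⟩
    rintro r ⟨x, _, y, _, rfl⟩
    exact dist_nonneg
  · exact ⟨x, hx, y, hy, rfl⟩

theorem Dtp_nonempty {G X : Type*} [Group G] [MetricSpace X] [MulAction G X] (A : Set X) (a b : X) :
    {r : ℝ | ∃ x ∈ gtp G A a, ∃ y ∈ gtp G A b, r = dist x y}.Nonempty :=
  ⟨_, a, ⟨1, stabSet_one, one_smul G a⟩, b, ⟨1, stabSet_one, one_smul G b⟩, rfl⟩

theorem gtp_conj {G X : Type*} [Group G] [MulAction G X] (h : G) {A : Set X} {a x : X}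
    (hx : x ∈ gtp G ((fun x => h • x) '' A) a) : h⁻¹ • x ∈ gtp G A (h⁻¹ • a) := by
  obtain ⟨u, hu, rfl⟩ := hx
  refine ⟨h⁻¹ * u * h, ?_, by simp [mul_smul]⟩
  intro z hz
  have := hu (h • z) ⟨z, hz, rfl⟩
  rw [mul_smul, mul_smul, this, inv_smul_smul]

/-- Extension of smooth independence over universal models. -/
theorem smoothIndep_extension {G X : Type*} [Group G] [MetricSpace X] [MulAction G X]
    (hiso : ∀ (g : G) (x y : X), dist (g • x) (g • y) = dist x y)
    (N M M' : Set X) (hNM : N ⊆ M) (hMM' : M ⊆ M')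
    (σ : Ordinal) (F : Ordinal → Set X) (hres : IsResolution σ F N)
    (h : G) (hh : h ∈ stabSet G N) (hhuniv : (fun x => h • x) '' M' ⊆ M)
    (hctp : ∀ x : X, IsClosed (gtp G M x))
    (a : X) (hindep : SmoothIndep G σ F M a) :
    ∃ b ∈ gtp G M a, SmoothIndep G σ F M' b := by
  refine ⟨h⁻¹ • a, ?_, ?_⟩
  · have key : h⁻¹ • a ∈ closure (gtp G M a) := by
      rw [Metric.mem_closure_iff]
      intro ε hε
      obtain ⟨i, hi, hns⟩ := hindep ε hε
      have hFN := hres.2.1 i hi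
      have hlt : Dtp G M (h⁻¹ • a) a < ε := by
        by_contra hcon
        apply hns
        refine ⟨(fun x => h • x) '' M, M, ?_, ?_, hFN.trans hNM, subset_rfl, h⁻¹, ?_, ?_, ?_⟩
        · intro x hx
          exact ⟨x, hNM (hFN hx), hh x (hFN hx)⟩
        · exact (image_mono hMM').trans hhuniv
        · intro x hx
          exact stabSet_inv hh x (hFN hx)
        · rw [image_image]
          simp
        · exact not_lt.mp hcon
      obtain ⟨r, ⟨x, ⟨u, hu, rfl⟩, y, ⟨v, hv, rfl⟩, rfl⟩, hr⟩ :=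
        exists_lt_of_csInf_lt (Dtp_nonempty M (h⁻¹ • a) a) hlt
      refine ⟨u⁻¹ • v • a, ⟨u⁻¹ * v, ?_, mul_smul _ _ _⟩, ?_⟩
      · intro z hz
        rw [mul_smul, hv z hz, stabSet_inv hu z hz]
      · rw [← hiso u, smul_inv_smul]
        exact hr
    rwa [(hctp a).closure_eq] at key
  · intro ε hε
    obtain ⟨i, hi, hns⟩ := hindep ε hε
    refine ⟨i, hi, ?_⟩
    have hFN := hres.2.1 i hi
    rintro ⟨N₁, N₂, h1, h2, h3, h4, g, hg, hgN, hD⟩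
    apply hns
    refine ⟨(fun x => h • x) '' N₁, (fun x => h • x) '' N₂, ?_, (image_mono h2).trans hhuniv,
      ?_, (image_mono h4).trans hhuniv, h * g * h⁻¹, ?_, ?_, ?_⟩
    · intro x hx
      exact ⟨x, h1 hx, hh x (hFN hx)⟩
    · intro x hx
      exact ⟨x, h3 hx, hh x (hFN hx)⟩
    · intro x hx
      rw [mul_smul, mul_smul, stabSet_inv hh x (hFN hx), hg x hx, hh x (hFN hx)]
    · rw [← hgN, image_image, image_image]
      simp [mul_smul]
    · apply le_csInf (Dtp_nonempty _ _ _)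
      rintro r ⟨x, hx, y, hy, rfl⟩
      have hx' := gtp_conj h hx
      have hy' := gtp_conj h hy
      rw [mul_smul, mul_smul, inv_smul_smul] at hx'
      rw [← hiso h⁻¹]
      exact hD.trans (Dtp_le hx' hy')
end

section
/- (Stationarity, second form: uniqueness of the smoothly independent extension.) Let N ⊆ M ⊆ M' ⊆ X and let 𝒩 be a resolution of N. Suppose there exists h ∈ G_N with h • M' ⊆ M (the group-theoretic rendering of 'M is universal over N'), and suppose every orbit of G_{M'} is closed in X (the Continuity of Types Property over M'). If b, c ∈ X satisfy G_M • b = G_M • c (they have the same Galois type over M), b ⌣[𝒩; N] M' and c ⌣[𝒩; N] M', then G_{M'} • b = G_{M'} • c (they have the same Galois type over M'). -/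
open Set Metric

theorem stabSet_mul {G X : Type*} [Group G] [MulAction G X] {A : Set X} {g k : G}
    (hg : g ∈ stabSet G A) (hk : k ∈ stabSet G A) : g * k ∈ stabSet G A := by
  intro x hx
  rw [mul_smul, hk x hx, hg x hx]

theorem gtp_self {G X : Type*} [Group G] [MulAction G X] (A : Set X) (a : X) :
    a ∈ gtp G A a := ⟨1, fun x _ => one_smul G x, one_smul G a⟩

theorem gtp_eq_of_mem {G X : Type*} [Group G] [MulAction G X] {A : Set X} {a b : X}
    (hm : b ∈ gtp G A a) : gtp G A b = gtp G A a := by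
  obtain ⟨g, hg, rfl⟩ := hm
  ext x
  constructor
  · rintro ⟨k, hk, rfl⟩
    exact ⟨k * g, stabSet_mul hk hg, mul_smul _ _ _⟩
  · rintro ⟨k, hk, rfl⟩
    exact ⟨k * g⁻¹, stabSet_mul hk (stabSet_inv hg), by rw [mul_smul, inv_smul_smul]⟩

theorem smoothIndep_key {G X : Type*} [Group G] [MetricSpace X] [MulAction G X]
    (hiso : ∀ (g : G) (x y : X), dist (g • x) (g • y) = dist x y)
    (N M M' : Set X) (hNM : N ⊆ M) (hMM' : M ⊆ M')
    (σ : Ordinal) (F : Ordinal → Set X) (hres : IsResolution σ F N)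
    (h : G) (hh : h ∈ stabSet G N) (hhuniv : (fun x => h • x) '' M' ⊆ M)
    (hctp : ∀ x : X, IsClosed (gtp G M' x))
    (a : X) (ha : SmoothIndep G σ F M' a) : a ∈ gtp G M' (h⁻¹ • a) := by
  rw [← (hctp (h⁻¹ • a)).closure_eq, Metric.mem_closure_iff]
  intro ε hε
  obtain ⟨i, hi, hs⟩ := ha ε hε
  have hFN := hres.2.1 i hi
  have hD : Dtp G M' (h⁻¹ • a) a < ε := by
    by_contra hcon
    refine hs ⟨(fun x => h • x) '' M', M', ?_, hhuniv.trans hMM',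
      hFN.trans (hNM.trans hMM'), subset_rfl, h⁻¹, ?_, ?_, not_lt.mp hcon⟩
    · intro x hx
      exact ⟨x, hMM' (hNM (hFN hx)), hh x (hFN hx)⟩
    · intro x hx
      exact stabSet_inv hh x (hFN hx)
    · ext x
      simp
  have hne : {r : ℝ | ∃ x ∈ gtp G M' (h⁻¹ • a), ∃ y ∈ gtp G M' a, r = dist x y}.Nonempty :=
    ⟨_, _, gtp_self M' (h⁻¹ • a), _, gtp_self M' a, rfl⟩
  obtain ⟨r, ⟨x, hx, y, ⟨g, hg, rfl⟩, rfl⟩, hr⟩ :=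
    exists_lt_of_csInf_lt hne hD
  obtain ⟨k, hk, rfl⟩ := hx
  refine ⟨(g⁻¹ * k) • h⁻¹ • a, ⟨_, stabSet_mul (stabSet_inv hg) hk, rfl⟩, ?_⟩
  rw [← hiso g, mul_smul, smul_inv_smul, dist_comm]
  exact hr

/-- Stationarity, second form: uniqueness of the smoothly independent extension. -/
theorem smoothIndep_unique_extension {G X : Type*} [Group G] [MetricSpace X] [MulAction G X]
    (hiso : ∀ (g : G) (x y : X), dist (g • x) (g • y) = dist x y)
    (N M M' : Set X) (hNM : N ⊆ M) (hMM' : M ⊆ M')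
    (σ : Ordinal) (F : Ordinal → Set X) (hres : IsResolution σ F N)
    (h : G) (hh : h ∈ stabSet G N) (hhuniv : (fun x => h • x) '' M' ⊆ M)
    (hctp : ∀ x : X, IsClosed (gtp G M' x))
    (b c : X) (htp : gtp G M b = gtp G M c)
    (hb : SmoothIndep G σ F M' b) (hc : SmoothIndep G σ F M' c) :
    gtp G M' b = gtp G M' c := by
  have kb := gtp_eq_of_mem (smoothIndep_key hiso N M M' hNM hMM' σ F hres h hh hhuniv hctp b hb)
  have kc := gtp_eq_of_mem (smoothIndep_key hiso N M M' hNM hMM' σ F hres h hh hhuniv hctp c hc)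
  rw [kb, kc]
  apply gtp_eq_of_mem
  have hbm : b ∈ gtp G M c := htp ▸ gtp_self M b
  obtain ⟨k, hk, rfl⟩ := hbm
  refine ⟨h⁻¹ * k * h, ?_, ?_⟩
  · intro x hx
    rw [mul_smul, mul_smul, hk (h • x) (hhuniv ⟨x, hx, rfl⟩), inv_smul_smul]
  · rw [mul_smul, mul_smul, smul_inv_smul]
end

section
/- (Antireflexivity of smooth independence.) Let M ⊆ N ⊆ X with M closed in X, and let 𝓜 = (M_i)_{i<θ} be a resolution of M such that for every i < θ there exists f ∈ G_{M_i} with f • N ⊆ M (the group-theoretic rendering of 'M is a limit model, universal over each M_i'). If a ∈ N and a ⌣[𝓜; M] N, then a ∈ M. -/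
open Set Metric

/-- Antireflexivity of smooth independence: over a limit model `M`, if `a ∈ N` is smoothly
independent from `N` over `M`, then `a ∈ M`. -/
theorem smoothIndep_antireflexive {G X : Type*} [Group G] [MetricSpace X] [MulAction G X]
    (hiso : ∀ (g : G) (x y : X), dist (g • x) (g • y) = dist x y)
    (M N : Set X) (hMN : M ⊆ N) (hMclosed : IsClosed M)
    (θ : Ordinal) (F : Ordinal → Set X) (hres : IsResolution θ F M)
    (hlim : ∀ i : Ordinal, i < θ → ∃ f ∈ stabSet G (F i), (fun x => f • x) '' N ⊆ M)
    (a : X) (haN : a ∈ N) (hindep : SmoothIndep G θ F N a) :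
    a ∈ M := by
  rw [← hMclosed.closure_eq, Metric.mem_closure_iff]
  intro ε hε
  obtain ⟨i, hi, hns⟩ := hindep ε hε
  obtain ⟨f, hf, hfN⟩ := hlim i hi
  have hFM : F i ⊆ M := hres.2.1 i hi
  have hfa : f • a ∈ (fun x => f • x) '' N := ⟨a, haN, rfl⟩
  have hlt : Dtp G ((fun x => f • x) '' N) (f • a) a < ε := by
    by_contra hc
    exact hns ⟨N, (fun x => f • x) '' N, hFM.trans hMN, subset_rfl,
      fun x hx => ⟨x, hMN (hFM hx), hf x hx⟩, hfN.trans hMN, f, hf, rfl, not_lt.mp hc⟩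
  have h1 : (1 : G) ∈ stabSet G ((fun x => f • x) '' N) := fun x _ => one_smul G x
  obtain ⟨r, ⟨x, ⟨k, hk, rfl⟩, y, ⟨h, hh, rfl⟩, rfl⟩, hr⟩ := exists_lt_of_csInf_lt
    (⟨_, _, ⟨1, h1, rfl⟩, _, ⟨1, h1, rfl⟩, rfl⟩ : Set.Nonempty
      {r : ℝ | ∃ x ∈ gtp G ((fun x => f • x) '' N) (f • a),
        ∃ y ∈ gtp G ((fun x => f • x) '' N) a, r = dist x y}) hlt
  refine ⟨f • a, hfN hfa, ?_⟩
  rw [hk _ hfa] at hr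
  have h2 := hh _ hfa
  rw [← hiso h, h2, dist_comm]
  exact hr
end

section
/- (Continuity of smooth independence.) Let N ⊆ M ⊆ X, let 𝒩 be a resolution of N, and let (b_n)_{n<ω} be a sequence in X converging to b ∈ X. If b_n ⌣[𝒩; N] M for every n < ω, then b ⌣[𝒩; N] M. -/
open Set Metric

/-- Continuity of smooth independence: a limit of smoothly independent elements is
smoothly independent. -/
theorem smoothIndep_continuity {G X : Type*} [Group G] [MetricSpace X] [MulAction G X]
    (hiso : ∀ (g : G) (x y : X), dist (g • x) (g • y) = dist x y)
    (N M : Set X) (hNM : N ⊆ M)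
    (σ : Ordinal) (F : Ordinal → Set X) (hres : IsResolution σ F N)
    (b : ℕ → X) (blim : X) (hlim : Filter.Tendsto b Filter.atTop (nhds blim))
    (h : ∀ n : ℕ, SmoothIndep G σ F M (b n)) :
    SmoothIndep G σ F M blim := by
  intro ε hε
  obtain ⟨n, hn⟩ := ((Metric.tendsto_nhds.1 hlim) (ε / 4) (by positivity)).exists
  obtain ⟨i, hi, hns⟩ := h n (ε / 2) (by positivity)
  refine ⟨i, hi, fun hs => hns ?_⟩
  obtain ⟨N₁, N₂, h1, h2, h3, h4, g, hg, himg, hD⟩ := hs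
  refine ⟨N₁, N₂, h1, h2, h3, h4, g, hg, himg, ?_⟩
  have h1G : (1 : G) ∈ stabSet G N₂ := fun x _ => one_smul G x
  unfold Dtp
  apply le_csInf
  · exact ⟨_, _, ⟨1, h1G, rfl⟩, _, ⟨1, h1G, rfl⟩, rfl⟩
  · rintro r ⟨x, ⟨k, hk, rfl⟩, y, ⟨l, hl, rfl⟩, rfl⟩
    have hle : Dtp G N₂ (g • blim) blim ≤ dist (k • g • blim) (l • blim) := by
      unfold Dtp
      apply csInf_le
      · refine ⟨0, ?_⟩
        rintro r ⟨x, _, y, _, rfl⟩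
        exact dist_nonneg
      · exact ⟨_, ⟨k, hk, rfl⟩, _, ⟨l, hl, rfl⟩, rfl⟩
    have ht := dist_triangle4 (k • g • blim) (k • g • b n) (l • b n) (l • blim)
    rw [hiso k, hiso g, hiso l (b n) blim, dist_comm blim (b n)] at ht
    linarith
end

section
/- (Transitivity of smooth independence.) Let M₀ ⊆ M₁ ⊆ M₂ ⊆ X, let 𝓜₀ = (M⁰_i)_{i<σ₀} be a resolution of M₀ and 𝓜₁ = (M¹_i)_{i<σ₁} a resolution of M₁ such that every member of the family 𝓜₀ occurs as a member of the family 𝓜₁. Suppose: (i) there exists h ∈ G_{M₀} with h • M₂ ⊆ M₁ (the group-theoretic rendering of 'M₁ is universal over M₀'); (ii) for every i < σ₁ there exist j with i < j < σ₁ and f ∈ G_{M¹_i} with f • M₂ ⊆ M¹_j (the group-theoretic rendering of 'M₁ is a limit model witnessed by 𝓜₁'); (iii) every orbit of G_{M₁} and every orbit of G_{M₂} is closed in X (the Continuity of Types Property over M₁ and over M₂). Then a ⌣[𝓜₀; M₀] M₂ if and only if both a ⌣[𝓜₀; M₀] M₁ and a ⌣[𝓜₁; M₁] M₂. -/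
open Set Metric

theorem Dtp_lt_iff' {G X : Type*} [Group G] [MetricSpace X] [MulAction G X]
    (hiso : ∀ (g : G) (x y : X), dist (g • x) (g • y) = dist x y)
    (A : Set X) (a b : X) (ε : ℝ) :
    Dtp G A a b < ε ↔ ∃ k ∈ stabSet G A, dist (k • a) b < ε := by
  constructor
  · intro h
    obtain ⟨r, ⟨x, ⟨g, hg, rfl⟩, y, ⟨g', hg', rfl⟩, rfl⟩, hr⟩ := exists_lt_of_csInf_lt
      (s := {r : ℝ | ∃ x ∈ gtp G A a, ∃ y ∈ gtp G A b, r = dist x y}) ⟨dist a b, a, ⟨1, fun x _ => one_smul _ x, one_smul _ a⟩, b,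
        ⟨1, fun x _ => one_smul _ x, one_smul _ b⟩, rfl⟩ h
    refine ⟨g'⁻¹ * g, ?_, ?_⟩
    · intro x hx
      rw [mul_smul, hg x hx, inv_smul_eq_iff, hg' x hx]
    · rw [← hiso g', mul_smul, smul_inv_smul]
      exact hr
  · rintro ⟨k, hk, hd⟩
    refine lt_of_le_of_lt (csInf_le ⟨0, ?_⟩ ⟨k • a, ⟨k, hk, rfl⟩, b,
        ⟨1, fun x _ => one_smul _ x, one_smul _ b⟩, rfl⟩) hd
    rintro r ⟨x, _, y, _, rfl⟩
    exact dist_nonneg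

theorem nonsplit_iff' {G X : Type*} [Group G] [MetricSpace X] [MulAction G X]
    (hiso : ∀ (g : G) (x y : X), dist (g • x) (g • y) = dist x y)
    (ε : ℝ) (N M : Set X) (a : X) :
    ¬ EpsSplits G ε N M a ↔ ∀ g ∈ stabSet G N, ∀ N₁ : Set X, N ⊆ N₁ → N₁ ⊆ M →
      (∀ x ∈ N₁, g • x ∈ M) → ∃ l : G, (∀ x ∈ N₁, l • x = g • x) ∧ dist (l • a) a < ε := by
  constructor
  · intro h g hg N₁ h1 h2 h3
    have h4 : Dtp G ((fun x => g • x) '' N₁) (g • a) a < ε := by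
      by_contra hc
      refine h ⟨N₁, _, h1, h2, ?_, ?_, g, hg, rfl, not_lt.mp hc⟩
      · intro x hx
        exact ⟨x, h1 hx, hg x hx⟩
      · rintro _ ⟨x, hx, rfl⟩
        exact h3 x hx
    obtain ⟨k, hk, hd⟩ := (Dtp_lt_iff' hiso _ _ _ _).1 h4
    refine ⟨k * g, ?_, ?_⟩
    · intro x hx
      rw [mul_smul]
      exact hk _ ⟨x, hx, rfl⟩
    · rwa [mul_smul]
  · rintro h ⟨N₁, N₂, h1, h2, h3, h4, g, hg, rfl, hd⟩
    obtain ⟨l, hl, hla⟩ := h g hg N₁ h1 h2 (fun x hx => h4 ⟨x, hx, rfl⟩)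
    refine absurd ((Dtp_lt_iff' hiso _ _ _ _).2 ⟨l * g⁻¹, ?_, ?_⟩) (not_lt.mpr hd)
    · rintro _ ⟨x, hx, rfl⟩
      simp only [mul_smul, inv_smul_smul]
      exact hl x hx
    · rwa [mul_smul, inv_smul_smul]

theorem EpsSplits.mono' {G X : Type*} [Group G] [MetricSpace X] [MulAction G X]
    {ε : ℝ} {N N' M M' : Set X} {a : X} (hN : N ⊆ N') (hM : M ⊆ M')
    (h : EpsSplits G ε N' M a) : EpsSplits G ε N M' a := by
  obtain ⟨N₁, N₂, h1, h2, h3, h4, g, hg, h5⟩ := h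
  exact ⟨N₁, N₂, hN.trans h1, h2.trans hM, hN.trans h3, h4.trans hM, g,
    fun x hx => hg x (hN hx), h5⟩

/-- Transitivity of smooth independence. -/
theorem smoothIndep_transitivity {G X : Type*} [Group G] [MetricSpace X] [MulAction G X]
    (hiso : ∀ (g : G) (x y : X), dist (g • x) (g • y) = dist x y)
    (M₀ M₁ M₂ : Set X) (h01 : M₀ ⊆ M₁) (h12 : M₁ ⊆ M₂)
    (σ₀ σ₁ : Ordinal) (F₀ F₁ : Ordinal → Set X)
    (hres₀ : IsResolution σ₀ F₀ M₀) (hres₁ : IsResolution σ₁ F₁ M₁)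
    (hsub : ∀ i : Ordinal, i < σ₀ → ∃ j : Ordinal, j < σ₁ ∧ F₀ i = F₁ j)
    (huniv : ∃ h ∈ stabSet G M₀, (fun x => h • x) '' M₂ ⊆ M₁)
    (hlim : ∀ i : Ordinal, i < σ₁ → ∃ j : Ordinal, i < j ∧ j < σ₁ ∧
      ∃ f ∈ stabSet G (F₁ i), (fun x => f • x) '' M₂ ⊆ F₁ j)
    (hctp₁ : ∀ x : X, IsClosed (gtp G M₁ x)) (hctp₂ : ∀ x : X, IsClosed (gtp G M₂ x))
    (a : X) :
    SmoothIndep G σ₀ F₀ M₂ a ↔ (SmoothIndep G σ₀ F₀ M₁ a ∧ SmoothIndep G σ₁ F₁ M₂ a) := by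
  have base : ∀ b : X, SmoothIndep G σ₀ F₀ M₂ b → SmoothIndep G σ₁ F₁ M₂ b := by
    intro b h ε hε
    obtain ⟨i, hi, hs⟩ := h ε hε
    obtain ⟨j, hj, e⟩ := hsub i hi
    exact ⟨j, hj, e ▸ hs⟩
  constructor
  · intro h
    refine ⟨fun ε hε => ?_, base a h⟩
    obtain ⟨i, hi, hs⟩ := h ε hε
    exact ⟨i, hi, fun hc => hs (hc.mono' subset_rfl h12)⟩
  rintro ⟨hA, hB⟩
  obtain ⟨h, hh, hM⟩ := huniv
  have hM' : ∀ x ∈ M₂, h • x ∈ M₁ := fun x hx => hM ⟨x, hx, rfl⟩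
  have hcl : ∀ (A : Set X) (b : X), IsClosed (gtp G A a) →
      (∀ ε : ℝ, 0 < ε → ∃ k ∈ stabSet G A, dist (k • a) b < ε) → b ∈ gtp G A a := by
    intro A b hc hd
    rw [← hc.closure_eq, Metric.mem_closure_iff]
    intro ε hε
    obtain ⟨k, hk, hk'⟩ := hd ε hε
    exact ⟨k • a, ⟨k, hk, rfl⟩, by rwa [dist_comm]⟩
  -- the nonsplitting extension
  have hb0 : SmoothIndep G σ₀ F₀ M₂ (h⁻¹ • a) := by
    intro ε hε
    obtain ⟨i, hi, hs⟩ := hA ε hε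
    refine ⟨i, hi, ?_⟩
    rw [nonsplit_iff' hiso] at hs ⊢
    have hF : ∀ x ∈ F₀ i, h • x = x := fun x hx => hh x (hres₀.2.1 i hi hx)
    intro g hg N₁ h1 h2 h3
    obtain ⟨l, hl, hd⟩ := hs (h * g * h⁻¹) (by
        intro x hx
        have e : h⁻¹ • x = x := by rw [inv_smul_eq_iff, hF x hx]
        rw [mul_smul, mul_smul, e, hg x hx, hF x hx])
      ((fun x => h • x) '' N₁)
      (fun x hx => ⟨x, h1 hx, hF x hx⟩)
      (by rintro _ ⟨x, hx, rfl⟩; exact hM' x (h2 hx))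
      (by
        rintro _ ⟨x, hx, rfl⟩
        simp only [mul_smul, inv_smul_smul]
        exact hM' _ (h3 x hx))
    refine ⟨h⁻¹ * l * h, ?_, ?_⟩
    · intro x hx
      have := hl _ ⟨x, hx, rfl⟩
      simp only [mul_smul, inv_smul_smul] at this ⊢
      rw [this, inv_smul_smul]
    · rw [mul_smul, mul_smul, smul_inv_smul, hiso]
      exact hd
  -- same type over M₁
  obtain ⟨k, hk, hka⟩ : h⁻¹ • a ∈ gtp G M₁ a := by
    refine hcl _ _ (hctp₁ a) fun ε hε => ?_
    obtain ⟨i, hi, hs⟩ := hA ε hε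
    rw [nonsplit_iff' hiso] at hs
    have hF := hres₀.2.1 i hi
    obtain ⟨l, hl, hd⟩ := hs h (fun x hx => hh x (hF hx)) M₁ (hF.trans h01) subset_rfl
      (fun x hx => hM' x (h12 hx))
    refine ⟨h⁻¹ * l, ?_, ?_⟩
    · intro x hx
      rw [mul_smul, hl x hx, inv_smul_smul]
    · rw [mul_smul, hiso]
      exact hd
  have hb1 := base _ hb0
  generalize h⁻¹ • a = b at hb0 hb1 hka
  -- same type over M₂
  obtain ⟨k', hk', hka'⟩ : b ∈ gtp G M₂ a := by
    refine hcl _ _ (hctp₂ a) fun ε hε => ?_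
    obtain ⟨i₁, hi₁, hs₁⟩ := hB (ε / 2) (half_pos hε)
    obtain ⟨i₂, hi₂, hs₂⟩ := hb1 (ε / 2) (half_pos hε)
    have hi : max i₁ i₂ < σ₁ := max_lt hi₁ hi₂
    have hs₁' : ¬ EpsSplits G (ε / 2) (F₁ (max i₁ i₂)) M₂ a := fun hc => hs₁ (EpsSplits.mono' (hres₁.1 _ _ (le_max_left i₁ i₂) hi)
      subset_rfl hc)
    have hs₂' : ¬ EpsSplits G (ε / 2) (F₁ (max i₁ i₂)) M₂ b := fun hc => hs₂ (EpsSplits.mono' (hres₁.1 _ _ (le_max_right i₁ i₂) hi)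
      subset_rfl hc)
    rw [nonsplit_iff' hiso] at hs₁' hs₂'
    obtain ⟨j, -, hj, f, hf, hfM⟩ := hlim _ hi
    have hfM' : ∀ x ∈ M₂, f • x ∈ M₁ := fun x hx => hres₁.2.1 j hj (hfM ⟨x, hx, rfl⟩)
    have hF := (hres₁.2.1 _ hi).trans h12
    obtain ⟨l₁, hl₁, hd₁⟩ := hs₁' f hf M₂ hF subset_rfl (fun x hx => h12 (hfM' x hx))
    obtain ⟨l₂, hl₂, hd₂⟩ := hs₂' f hf M₂ hF subset_rfl (fun x hx => h12 (hfM' x hx))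
    refine ⟨l₂⁻¹ * k * l₁, ?_, ?_⟩
    · intro x hx
      rw [mul_smul, mul_smul, hl₁ x hx, hk _ (hfM' x hx), inv_smul_eq_iff, hl₂ x hx]
    · rw [← hiso l₂, mul_smul, mul_smul, smul_inv_smul]
      have e : dist (k • l₁ • a) b < ε / 2 := by
        rw [← hka, hiso]
        exact hd₁
      have := dist_triangle_right (k • l₁ • a) (l₂ • b) b
      linarith
  intro ε hε
  obtain ⟨i, hi, hs⟩ := hb0 ε hε
  refine ⟨i, hi, ?_⟩
  rw [nonsplit_iff' hiso] at hs ⊢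
  intro g hg N₁ h1 h2 h3
  obtain ⟨l, hl, hd⟩ := hs g hg N₁ h1 h2 h3
  refine ⟨k'⁻¹ * l * k', ?_, ?_⟩
  · intro x hx
    rw [mul_smul, mul_smul, hk' x (h2 hx), hl x hx, inv_smul_eq_iff, hk' _ (h3 x hx)]
  · rw [← hiso k', mul_smul, mul_smul, smul_inv_smul, hka']
    exact hd
end
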